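/- arXiv:1512.05871 — 5 statements merged into one kernel-verified Lean document; each statement's English description precedes it below -/
import Mathlib

section
/- (Georgii–Nguyen–Zessin formula, finite case.) Let f be a hereditary point process density on S, i.e. f(x ∪ {x₀}) > 0 implies f(x) > 0 for every finite configuration x and point x₀ ∉ x. Define λ^{(n)}((x₁,…,x_n), x) = f(x ∪ {x₁,…,x_n}) / f(x) with the convention 0/0 = 0. Then for every n ≥ 1 and every nonnegative measurable h on S^n × (finite configurations): E₀[ f(x) · Σ^{≠}_{(x₁,…,x_n) ∈ x} h((x₁,…,x_n), x \ {x₁,…,x_n}) ] = ∫_{S^n} E₀[ f(x) · λ^{(n)}((x₁,…,x_n), x) · h((x₁,…,x_n), x) ] dx₁⋯dx_n. -/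
open MeasureTheory ENNReal
open scoped Classical

noncomputable section

namespace PalmTutorial

/-- A finite point configuration in `ℝ^d`. -/
abbrev Config (d : ℕ) := Finset (Fin d → ℝ)

/-- The configuration `{x₁, …, x_n}` determined by a tuple `(x₁, …, x_n)`. -/
def tupCfg {d n : ℕ} (x : Fin n → (Fin d → ℝ)) : Config d :=
  Finset.image x Finset.univ

/-- The distribution of an `n`-tuple of independent uniform points: the `n`-fold product
of Lebesgue measure restricted to `S` (i.e. integration over `S^n`). -/
def restMeas (d : ℕ) (S : Set (Fin d → ℝ)) (n : ℕ) : Measure (Fin n → (Fin d → ℝ)) :=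
  Measure.pi fun _ => volume.restrict S

/-- The unit-rate Poisson expectation
`E₀[F] = Σ_{n=0}^∞ (e^{−|S|}/n!) ∫_{S^n} F({x₁,…,x_n}) dx₁⋯dx_n`. -/
def E₀ {d : ℕ} (S : Set (Fin d → ℝ)) (F : Config d → ℝ≥0∞) : ℝ≥0∞ :=
  ∑' n : ℕ, (ENNReal.ofReal (Real.exp (-(volume S).toReal)) / (Nat.factorial n : ℝ≥0∞)) *
    ∫⁻ x, F (tupCfg x) ∂(restMeas d S n)

/-- A function `F` on finite configurations is measurable if for each `n` the map
`(x₁,…,x_n) ↦ F({x₁,…,x_n})` is Borel measurable. -/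
def MeasCfg {d : ℕ} (F : Config d → ℝ≥0∞) : Prop :=
  ∀ n : ℕ, Measurable fun x : Fin n → (Fin d → ℝ) => F (tupCfg x)

/-- The `n`-th order joint intensity `ρ^{(n)}(x₁,…,x_n) = E₀[f(· ∪ {x₁,…,x_n})]`. -/
def jointIntensity {d : ℕ} (S : Set (Fin d → ℝ)) (f : Config d → ℝ≥0∞) {n : ℕ}
    (x : Fin n → (Fin d → ℝ)) : ℝ≥0∞ :=
  E₀ S fun c => f (c ∪ tupCfg x)

/-- The reduced Palm density `f_{x₁,…,x_n}(x) = f(x ∪ {x₁,…,x_n}) / ρ^{(n)}(x₁,…,x_n)`. -/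
def palmDensity {d : ℕ} (S : Set (Fin d → ℝ)) (f : Config d → ℝ≥0∞) {n : ℕ}
    (x : Fin n → (Fin d → ℝ)) (c : Config d) : ℝ≥0∞ :=
  f (c ∪ tupCfg x) / jointIntensity S f x

/-- `Σ^{≠}_{(x₁,…,x_n) ∈ c} h(x₁,…,x_n)`: the sum of `h` over all `n`-tuples of pairwise
distinct points of the configuration `c`. -/
def sumDistinct {d n : ℕ} (c : Config d) (h : (Fin n → (Fin d → ℝ)) → ℝ≥0∞) : ℝ≥0∞ :=
  ∑ x ∈ (Fintype.piFinset fun _ : Fin n => c).filter Function.Injective, h x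

lemma tupCfg_comp_equiv {d n m : ℕ} (y : Fin m → (Fin d → ℝ)) (σ : Fin n ≃ Fin m) :
    tupCfg (y ∘ σ) = tupCfg y := by
  ext a
  simp only [tupCfg, Finset.mem_image, Finset.mem_univ, true_and, Function.comp_apply]
  exact (σ.surjective.exists (p := fun i => y i = a)).symm

lemma tupCfg_eq_union {d n k : ℕ} (y : Fin (n + k) → (Fin d → ℝ)) :
    tupCfg y = tupCfg (y ∘ Fin.castAdd k) ∪ tupCfg (y ∘ Fin.natAdd n) := by
  ext a
  simp only [tupCfg, Finset.mem_image, Finset.mem_univ, true_and, Function.comp_apply,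
    Finset.mem_union]
  constructor
  · rintro ⟨i, rfl⟩
    induction i using Fin.addCases with
    | left i => exact Or.inl ⟨i, rfl⟩
    | right i => exact Or.inr ⟨i, rfl⟩
  · rintro (⟨i, rfl⟩ | ⟨i, rfl⟩) <;> exact ⟨_, rfl⟩

lemma tupCfg_sdiff {d n k : ℕ} {y : Fin (n + k) → (Fin d → ℝ)} (hy : Function.Injective y) :
    tupCfg y \ tupCfg (y ∘ Fin.castAdd k) = tupCfg (y ∘ Fin.natAdd n) := by
  rw [tupCfg_eq_union, Finset.union_sdiff_left, Finset.sdiff_eq_self_iff_disjoint,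
    Finset.disjoint_left]
  simp only [tupCfg, Finset.mem_image, Finset.mem_univ, true_and, Function.comp_apply]
  rintro _ ⟨i, rfl⟩ ⟨j, hij⟩
  have h := congrArg Fin.val (hy hij)
  simp only [Fin.val_castAdd, Fin.val_natAdd] at h
  omega

/-- The sum over distinct tuples of points of an injectively parametrized configuration is
a sum over embeddings of the index sets. -/
lemma sumDistinct_tupCfg {d n m : ℕ} {y : Fin m → (Fin d → ℝ)} (hy : Function.Injective y)
    (g : (Fin n → (Fin d → ℝ)) → ℝ≥0∞) :
    sumDistinct (tupCfg y) g = ∑ e : Fin n ↪ Fin m, g (y ∘ e) := by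
  symm
  unfold sumDistinct
  refine Finset.sum_bij (fun e _ => y ∘ e) ?_ ?_ ?_ ?_
  · intro e _
    simp only [Finset.mem_filter, Fintype.mem_piFinset, tupCfg]
    exact ⟨fun i => Finset.mem_image_of_mem _ (Finset.mem_univ _), hy.comp e.injective⟩
  · intro e _ e' _ hee
    ext i
    exact congrArg Fin.val (hy (congrFun hee i))
  · intro x hx
    simp only [Finset.mem_filter, Fintype.mem_piFinset, tupCfg, Finset.mem_image,
      Finset.mem_univ, true_and] at hx
    choose e he using hx.1
    refine ⟨⟨e, fun i j hij => hx.2 ?_⟩, Finset.mem_univ _, funext he⟩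
    rw [← he i, ← he j, hij]
  · intro e _
    rfl

lemma exists_perm_extend {n k : ℕ} (e : Fin n ↪ Fin (n + k)) :
    ∃ σ : Equiv.Perm (Fin (n + k)), σ ∘ Fin.castAdd k = e := by
  obtain ⟨σ, hσ⟩ := Equiv.Perm.exists_extending_pair (Fin.castAdd k) e
    (Fin.castAdd_injective n k) e.injective
  exact ⟨σ, funext hσ⟩

lemma ae_injective {d : ℕ} (hd : 1 ≤ d) (S : Set (Fin d → ℝ)) (m : ℕ) :
    ∀ᵐ y ∂(restMeas d S m), Function.Injective y := by
  have hvol : ∀ᵐ y : Fin m → (Fin d → ℝ), Function.Injective y := by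
    have hne : ∀ i j : Fin m, i ≠ j → ∀ᵐ y : Fin m → (Fin d → ℝ), y i ≠ y j := by
      intro i j hij
      let E : Submodule ℝ (Fin m → (Fin d → ℝ)) :=
        LinearMap.ker (LinearMap.proj i - LinearMap.proj (R := ℝ) (φ := fun _ => Fin d → ℝ) j)
      have hE : E ≠ ⊤ := by
        intro h
        have hmem : (Pi.single i (fun _ => 1) : Fin m → (Fin d → ℝ)) ∈ E := h ▸ Submodule.mem_top
        have h0 : (fun _ => 1 : Fin d → ℝ) = 0 := by
          simpa [E, LinearMap.mem_ker, Pi.single_eq_of_ne hij.symm] using hmem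
        exact one_ne_zero (congrFun h0 ⟨0, hd⟩)
      have h0 := Measure.addHaar_submodule volume E hE
      rw [ae_iff]
      convert h0 using 2
      ext y
      simp [E, LinearMap.mem_ker, sub_eq_zero]
    have hall : ∀ᵐ y : Fin m → (Fin d → ℝ), ∀ i j, i ≠ j → y i ≠ y j := by
      simp only [ae_all_iff]
      exact hne
    filter_upwards [hall] with y hy i j hij
    by_contra hne
    exact hy i j hne hij
  have hrest : restMeas d S m = volume.restrict (Set.univ.pi fun _ => S) :=
    (Measure.restrict_pi_pi (fun _ : Fin m => (volume : Measure (Fin d → ℝ))) _).symm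
  rw [hrest]
  exact ae_restrict_of_ae hvol

lemma measurePreserving_comp_perm {d m : ℕ} (S : Set (Fin d → ℝ)) (σ : Equiv.Perm (Fin m)) :
    MeasurePreserving (fun y : Fin m → (Fin d → ℝ) => y ∘ σ) (restMeas d S m)
      (restMeas d S m) := by
  have h := measurePreserving_piCongrLeft
    (fun _ : Fin m => (volume.restrict S : Measure (Fin d → ℝ))) σ
  exact h.symm

lemma measurePreserving_split {d : ℕ} (S : Set (Fin d → ℝ)) (n k : ℕ) :
    MeasurePreserving (fun y : Fin (n + k) → (Fin d → ℝ) =>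
        (y ∘ Fin.castAdd k, y ∘ Fin.natAdd n))
      (restMeas d S (n + k)) ((restMeas d S n).prod (restMeas d S k)) := by
  have h1 := measurePreserving_piCongrLeft
    (fun _ : Fin (n + k) => (volume.restrict S : Measure (Fin d → ℝ))) finSumFinEquiv
  have h2 := measurePreserving_sumPiEquivProdPi
    (fun _ : Fin n ⊕ Fin k => (volume.restrict S : Measure (Fin d → ℝ)))
  exact h2.comp h1.symm

/-- A hereditary function vanishing at `c` vanishes at every configuration containing `c`. -/
lemma hereditary_union_eq_zero {d : ℕ} {f : Config d → ℝ≥0∞}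
    (hher : ∀ (c : Config d) (x₀ : Fin d → ℝ), x₀ ∉ c → 0 < f (insert x₀ c) → 0 < f c)
    {c : Config d} (hc : f c = 0) (s : Config d) : f (c ∪ s) = 0 := by
  induction s using Finset.induction_on with
  | empty => simpa using hc
  | insert a s _ ih =>
    rw [Finset.union_insert]
    by_cases ha : a ∈ c ∪ s
    · rwa [Finset.insert_eq_of_mem ha]
    · by_contra hne
      exact (hher _ a ha (pos_iff_ne_zero.2 hne)).ne' ih

lemma poissonWeight_ne_zero {d : ℕ} (S : Set (Fin d → ℝ)) (m : ℕ) :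
    ENNReal.ofReal (Real.exp (-(volume S).toReal)) / (Nat.factorial m : ℝ≥0∞) ≠ 0 :=
  ENNReal.div_ne_zero.2 ⟨(ENNReal.ofReal_pos.2 (Real.exp_pos _)).ne', ENNReal.natCast_ne_top _⟩

lemma ae_lt_top_of_E₀_ne_top {d : ℕ} {S : Set (Fin d → ℝ)} {f : Config d → ℝ≥0∞}
    (hfm : MeasCfg f) (hf : E₀ S f ≠ ∞) (m : ℕ) :
    ∀ᵐ z ∂(restMeas d S m), f (tupCfg z) < ∞ := by
  refine ae_lt_top (hfm m) fun htop => ?_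
  have h := ENNReal.ne_top_of_tsum_ne_top hf m
  rw [htop, ENNReal.mul_top (poissonWeight_ne_zero S m)] at h
  exact h rfl

lemma poissonWeight_mul_card {n k : ℕ} (a : ℝ≥0∞) :
    a / (Nat.factorial (n + k) : ℝ≥0∞) * (Fintype.card (Fin n ↪ Fin (n + k)) : ℝ≥0∞) =
      a / (Nat.factorial k : ℝ≥0∞) := by
  have h := Nat.factorial_mul_descFactorial (Nat.le_add_right n k)
  rw [Nat.add_sub_cancel_left] at h
  have hD : ((n + k).descFactorial n : ℝ≥0∞) ≠ 0 := by
    rw [Nat.cast_ne_zero]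
    intro h0
    rw [h0, mul_zero] at h
    exact (Nat.factorial_pos _).ne h
  rw [Fintype.card_embedding_eq, Fintype.card_fin, Fintype.card_fin, ← h, Nat.cast_mul,
    div_eq_mul_inv, ENNReal.mul_inv (Or.inr (ENNReal.natCast_ne_top _)) (Or.inr hD), mul_assoc,
    mul_assoc, ENNReal.inv_mul_cancel hD (ENNReal.natCast_ne_top _), mul_one, div_eq_mul_inv]

/-- Slivnyak–Mecke formula for the finite Poisson expectation. -/
lemma E₀_sumDistinct {d : ℕ} (hd : 1 ≤ d) (S : Set (Fin d → ℝ))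
    {f : Config d → ℝ≥0∞} (hfm : MeasCfg f) {n : ℕ}
    {h : (Fin n → (Fin d → ℝ)) → Config d → ℝ≥0∞}
    (hh : ∀ m : ℕ, Measurable fun p : (Fin n → (Fin d → ℝ)) × (Fin m → (Fin d → ℝ)) =>
      h p.1 (tupCfg p.2)) :
    E₀ S (fun c => f c * sumDistinct c (fun x => h x (c \ tupCfg x))) =
      ∫⁻ x, E₀ S (fun c => f (c ∪ tupCfg x) * h x c) ∂(restMeas d S n) := by
  have hmeas : ∀ k, Measurable fun p : (Fin n → (Fin d → ℝ)) × (Fin k → (Fin d → ℝ)) =>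
      f (tupCfg p.2 ∪ tupCfg p.1) * h p.1 (tupCfg p.2) := by
    intro k
    refine Measurable.mul ?_ (hh k)
    have happ : Measurable fun p : (Fin n → (Fin d → ℝ)) × (Fin k → (Fin d → ℝ)) =>
        (Fin.append p.1 p.2 : Fin (n + k) → (Fin d → ℝ)) := by
      refine measurable_pi_iff.2 fun i => ?_
      induction i using Fin.addCases with
      | left i => simpa only [Fin.append_left] using measurable_fst.eval
      | right i => simpa only [Fin.append_right] using measurable_snd.eval
    have hc := (hfm (n + k)).comp happ
    convert hc using 2 with p
    rw [Function.comp_apply, tupCfg_eq_union, Finset.union_comm]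
    congr 3 <;> ext i : 1 <;> simp
  have hsf : ∀ k, SFinite (restMeas d S k) := fun k => by
    unfold restMeas
    infer_instance
  have hterm : ∀ k, ∫⁻ y, f (tupCfg y) *
        sumDistinct (tupCfg y) (fun x => h x (tupCfg y \ tupCfg x)) ∂(restMeas d S (n + k)) =
      (Fintype.card (Fin n ↪ Fin (n + k)) : ℝ≥0∞) *
        ∫⁻ x, ∫⁻ z, f (tupCfg z ∪ tupCfg x) * h x (tupCfg z) ∂(restMeas d S k)
          ∂(restMeas d S n) := by
    intro k
    choose σ hσ using fun e : Fin n ↪ Fin (n + k) => exists_perm_extend e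
    let G : (Fin (n + k) → (Fin d → ℝ)) → ℝ≥0∞ := fun y =>
      f (tupCfg (y ∘ Fin.natAdd n) ∪ tupCfg (y ∘ Fin.castAdd k)) *
        h (y ∘ Fin.castAdd k) (tupCfg (y ∘ Fin.natAdd n))
    have hG : Measurable G := (hmeas k).comp (measurePreserving_split S n k).measurable
    have hsum : ∫⁻ y, f (tupCfg y) *
          sumDistinct (tupCfg y) (fun x => h x (tupCfg y \ tupCfg x)) ∂(restMeas d S (n + k)) =
        ∫⁻ y, ∑ e, G (y ∘ σ e) ∂(restMeas d S (n + k)) := by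
      refine lintegral_congr_ae ?_
      filter_upwards [ae_injective hd S (n + k)] with y hy
      rw [sumDistinct_tupCfg hy, Finset.mul_sum]
      refine Finset.sum_congr rfl fun e _ => ?_
      have h1 : y ∘ e = (y ∘ σ e) ∘ Fin.castAdd k := by rw [Function.comp_assoc, hσ]
      simp only [G]
      rw [h1, Finset.union_comm, ← tupCfg_eq_union, ← tupCfg_sdiff (hy.comp (σ e).injective),
        tupCfg_comp_equiv]
    have hGσ : ∀ e, Measurable fun y => G (y ∘ σ e) := fun e =>
      hG.comp (measurePreserving_comp_perm S (σ e)).measurable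
    rw [hsum, lintegral_finsetSum _ fun e _ => hGσ e]
    rw [Finset.sum_congr rfl fun e _ => (measurePreserving_comp_perm S (σ e)).lintegral_comp hG,
      Finset.sum_const, Finset.card_univ, nsmul_eq_mul,
      ← lintegral_prod _ (hmeas k).aemeasurable,
      ← (measurePreserving_split S n k).lintegral_comp (hmeas k)]
  have hzero : ∀ m, m < n → ∫⁻ y, f (tupCfg y) *
      sumDistinct (tupCfg y) (fun x => h x (tupCfg y \ tupCfg x)) ∂(restMeas d S m) = 0 := by
    intro m hm
    have : IsEmpty (Fin n ↪ Fin m) :=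
      Function.Embedding.isEmpty_of_card_lt (by simpa using hm)
    rw [← lintegral_zero (μ := restMeas d S m)]
    refine lintegral_congr_ae ?_
    filter_upwards [ae_injective hd S m] with y hy
    rw [sumDistinct_tupCfg hy, Finset.univ_eq_empty, Finset.sum_empty, mul_zero]
  have hinner : ∀ k, Measurable fun x =>
      ∫⁻ z, f (tupCfg z ∪ tupCfg x) * h x (tupCfg z) ∂(restMeas d S k) :=
    fun k => (hmeas k).lintegral_prod_right'
  unfold E₀
  rw [lintegral_tsum fun k => ((hinner k).const_mul _).aemeasurable,
    ← (add_right_injective n).tsum_eq]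
  · refine tsum_congr fun k => ?_
    rw [hterm, ← mul_assoc, poissonWeight_mul_card, lintegral_const_mul _ (hinner k)]
  · intro m hm
    by_contra hr
    refine hm ?_
    have hlt : m < n := by
      by_contra hle
      exact hr ⟨m - n, Nat.add_sub_cancel' (not_lt.1 hle)⟩
    simp only [hzero m hlt, mul_zero]

/-- Georgii–Nguyen–Zessin formula, finite case. Let `f` be a hereditary point
process density on `S` and let `λ^{(n)}((x₁,…,x_n), x) = f(x ∪ {x₁,…,x_n}) / f(x)` with the
convention `0/0 = 0` (which is the `ℝ≥0∞` convention). Then for every `n ≥ 1` and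
nonnegative measurable `h`:
`E₀[ f(x) · Σ^{≠}_{(x₁,…,x_n) ∈ x} h((x₁,…,x_n), x \ {x₁,…,x_n}) ]
  = ∫_{S^n} E₀[ f(x) λ^{(n)}((x₁,…,x_n), x) h((x₁,…,x_n), x) ] dx₁⋯dx_n`. -/
theorem statement3 {d : ℕ} (hd : 1 ≤ d) (S : Set (Fin d → ℝ)) (hSm : MeasurableSet S)
    (hSb : Bornology.IsBounded S)
    (f : Config d → ℝ≥0∞) (hfm : MeasCfg f) (hf : E₀ S f = 1)
    (hher : ∀ (c : Config d) (x₀ : Fin d → ℝ), x₀ ∉ c → 0 < f (insert x₀ c) → 0 < f c)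
    (n : ℕ) (hn : 1 ≤ n) (h : (Fin n → (Fin d → ℝ)) → Config d → ℝ≥0∞)
    (hh : ∀ m : ℕ, Measurable fun p : (Fin n → (Fin d → ℝ)) × (Fin m → (Fin d → ℝ)) =>
      h p.1 (tupCfg p.2)) :
    E₀ S (fun c => f c * sumDistinct c (fun x => h x (c \ tupCfg x))) =
      ∫⁻ x, E₀ S (fun c => f c * (f (c ∪ tupCfg x) / f c) * h x c) ∂(restMeas d S n) := by
  rw [E₀_sumDistinct hd S hfm hh]
  refine lintegral_congr fun x => tsum_congr fun k => ?_
  congr 1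
  refine lintegral_congr_ae ?_
  filter_upwards [ae_lt_top_of_E₀_ne_top hfm (hf.trans_ne ENNReal.one_ne_top) k] with z hz
  rw [ENNReal.mul_div_cancel' (fun h0 => hereditary_union_eq_zero hher h0 _)
    fun htop => absurd htop hz.ne]

end PalmTutorial
end
end

section
/- (Characterization of the Poisson process by Palm invariance, finite case.) Let f be a point process density on S and ρ : S → [0,∞) an integrable function such that f(x ∪ {x₀}) = ρ(x₀) · f(x) for every finite configuration x ⊆ S and every x₀ ∈ S \ x. Then f(x) = exp(|S| − ∫_S ρ(u) du) · Π_{u ∈ x} ρ(u) for every finite configuration x ⊆ S; in particular f is the density of the Poisson process on S with intensity function ρ. -/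
open MeasureTheory ENNReal
open scoped Classical

noncomputable section

namespace PalmTutorial

/-- Two distinct coordinates agree only on a null set of a product of atomless measures. -/
lemma ae_pi_apply_ne {α : Type*} [MeasurableSpace α] [MeasurableEq α]
    (μ : Measure α) [SigmaFinite μ] [NullSingletonClass μ] {n : ℕ} {i j : Fin n} (hij : i ≠ j) :
    ∀ᵐ x ∂(Measure.pi fun _ : Fin n => μ), x i ≠ x j := by
  cases n with
  | zero => exact i.elim0
  | succ n =>
    obtain ⟨k, rfl⟩ := Fin.exists_succAbove_eq hij.symm
    have hmp := measurePreserving_piFinSuccAbove (fun _ : Fin (n + 1) => μ) i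
    have hms : MeasurableSet {p : α × (Fin n → α) | p.1 = p.2 k} :=
      measurableSet_eq_fun measurable_fst ((measurable_pi_apply k).comp measurable_snd)
    have hnull : (μ.prod (Measure.pi fun _ : Fin n => μ)) {p | p.1 = p.2 k} = 0 := by
      rw [Measure.measure_prod_null hms]
      refine Filter.Eventually.of_forall fun a => ?_
      simpa [eq_comm] using Measure.pi_hyperplane (fun _ : Fin n => μ) k a
    rw [ae_iff]
    simpa [Fin.removeNth] using (hmp.measure_preimage hms.nullMeasurableSet).trans hnull

/-- Almost every tuple for a product of atomless measures has pairwise distinct entries. -/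
lemma ae_pi_injective {α : Type*} [MeasurableSpace α] [MeasurableEq α]
    (μ : Measure α) [SigmaFinite μ] [NullSingletonClass μ] (n : ℕ) :
    ∀ᵐ x ∂(Measure.pi fun _ : Fin n => μ), Function.Injective x := by
  have h : ∀ᵐ x ∂(Measure.pi fun _ : Fin n => μ), ∀ i j, i ≠ j → x i ≠ x j := by
    simp only [ae_all_iff]
    exact fun i j hij => ae_pi_apply_ne μ hij
  filter_upwards [h] with x hx i j hxij
  by_contra hij
  exact hx i j hij hxij

/-- The integral over a finite power of a product of copies of one function. -/
lemma lintegral_pi_prod_eq_pow {α : Type*} [MeasurableSpace α] (μ : Measure α) [SigmaFinite μ]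
    {g : α → ℝ≥0∞} (hg : Measurable g) (n : ℕ) :
    ∫⁻ x, ∏ i, g (x i) ∂(Measure.pi fun _ : Fin n => μ) = (∫⁻ a, g a ∂μ) ^ n := by
  induction n with
  | zero => simp
  | succ n ih =>
    have hmp := (measurePreserving_piFinSuccAbove (fun _ : Fin (n + 1) => μ) 0).symm
    rw [← hmp.lintegral_comp_emb (MeasurableEquiv.measurableEmbedding _)]
    simp only [MeasurableEquiv.piFinSuccAbove_symm_apply, Fin.prod_univ_succ,
      Fin.insertNthEquiv_zero, Fin.consEquiv_apply, Fin.cons_zero, Fin.cons_succ]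
    have hprod : Measurable fun x : Fin n → α => ∏ i, g (x i) := by fun_prop
    exact (lintegral_prod_mul hg.aemeasurable hprod.aemeasurable).trans (by rw [ih, pow_succ'])

/-- A function multiplicative under adding points is a constant times a product. -/
lemma eq_mul_prod_of_insert {α : Type*} [DecidableEq α] {S : Set α} {f : Finset α → ℝ≥0∞} {r : α → ℝ≥0∞}
    (h : ∀ (c : Finset α) (a : α), ↑c ⊆ S → a ∈ S → a ∉ c → f (insert a c) = r a * f c)
    (c : Finset α) (hc : ↑c ⊆ S) : f c = f ∅ * ∏ u ∈ c, r u := by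
  induction c using Finset.induction_on with
  | empty => simp
  | insert a c ha ih =>
    rw [Finset.coe_insert, Set.insert_subset_iff] at hc
    rw [h c a hc.2 hc.1 ha, Finset.prod_insert ha, ih hc.2]
    ring

/-- The unit-rate Poisson expectation of a multiplicative function of the configuration. -/
lemma E₀_eq_of_eq_mul_prod {d : ℕ} (hd : 1 ≤ d) {S : Set (Fin d → ℝ)} (hSm : MeasurableSet S)
    {f : Config d → ℝ≥0∞} {a : ℝ≥0∞} {ρ : (Fin d → ℝ) → ℝ} (hρ0 : ∀ u, 0 ≤ ρ u)
    (hρm : Measurable ρ) (hρint : IntegrableOn ρ S volume)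
    (hf : ∀ c : Config d, ↑c ⊆ S → f c = a * ∏ u ∈ c, ENNReal.ofReal (ρ u)) :
    E₀ S f = a * ENNReal.ofReal (Real.exp ((∫ u in S, ρ u) - (volume S).toReal)) := by
  have : Nonempty (Fin d) := ⟨⟨0, hd⟩⟩
  set I := ∫ u in S, ρ u with hI
  have hI0 : 0 ≤ I := integral_nonneg hρ0
  have hpow : ∀ n : ℕ, ∫⁻ x, f (tupCfg x) ∂(restMeas d S n) = a * ENNReal.ofReal I ^ n := by
    intro n
    have hS : ∀ᵐ x ∂(restMeas d S n), ∀ i, x i ∈ S :=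
      ae_all_iff.2 fun i => (Measure.tendsto_eval_ae_ae (i := i)).eventually (ae_restrict_mem hSm)
    have hae : (fun x => f (tupCfg x)) =ᵐ[restMeas d S n]
        fun x => a * ∏ i, ENNReal.ofReal (ρ (x i)) := by
      filter_upwards [hS, ae_pi_injective (volume.restrict S) n] with x hxS hx
      rw [hf _ (by simpa [tupCfg, Set.range_subset_iff] using hxS), tupCfg,
        Finset.prod_image hx.injOn]
    rw [lintegral_congr_ae hae, lintegral_const_mul _ (by fun_prop), restMeas,
      lintegral_pi_prod_eq_pow _ hρm.ennreal_ofReal,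
      ← ofReal_integral_eq_lintegral_ofReal hρint (.of_forall hρ0)]
  have hexp : ∑' n : ℕ, ENNReal.ofReal (I ^ n / n.factorial) = ENNReal.ofReal (Real.exp I) := by
    rw [← ENNReal.ofReal_tsum_of_nonneg (fun n => by positivity) (Real.summable_pow_div_factorial I),
      Real.exp_eq_exp_ℝ, NormedSpace.exp_eq_tsum_div]
  calc E₀ S f
      = ∑' n : ℕ, a * ENNReal.ofReal (Real.exp (-(volume S).toReal)) *
          ENNReal.ofReal (I ^ n / n.factorial) := by
        refine tsum_congr fun n => ?_
        rw [hpow, ENNReal.ofReal_div_of_pos (by positivity), ENNReal.ofReal_pow hI0,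
          ENNReal.ofReal_natCast, div_eq_mul_inv, div_eq_mul_inv]
        ring
    _ = a * ENNReal.ofReal (Real.exp (I - (volume S).toReal)) := by
        rw [ENNReal.tsum_mul_left, hexp, mul_assoc, ← ENNReal.ofReal_mul (Real.exp_pos _).le,
          ← Real.exp_add, neg_add_eq_sub]

/-- Characterization of the Poisson process by Palm invariance, finite case.
Let `f` be a point process density on `S` and `ρ : S → [0,∞)` integrable such that
`f(x ∪ {x₀}) = ρ(x₀) · f(x)` for every finite configuration `x ⊆ S` and every
`x₀ ∈ S \ x`. Then `f(x) = exp(|S| − ∫_S ρ(u) du) · Π_{u ∈ x} ρ(u)` for every finite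
configuration `x ⊆ S`; in particular `f` is the density of the Poisson process on `S`
with intensity function `ρ`. -/
theorem statement9 {d : ℕ} (hd : 1 ≤ d) (S : Set (Fin d → ℝ)) (hSm : MeasurableSet S)
    (hSb : Bornology.IsBounded S)
    (f : Config d → ℝ≥0∞) (hfm : MeasCfg f) (hf : E₀ S f = 1)
    (ρ : (Fin d → ℝ) → ℝ) (hρ0 : ∀ u, 0 ≤ ρ u) (hρm : Measurable ρ)
    (hρint : IntegrableOn ρ S volume)
    (hpalm : ∀ (c : Config d) (x₀ : Fin d → ℝ), ↑c ⊆ S → x₀ ∈ S → x₀ ∉ c →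
      f (insert x₀ c) = ENNReal.ofReal (ρ x₀) * f c) :
    ∀ c : Config d, ↑c ⊆ S →
      f c = ENNReal.ofReal (Real.exp ((volume S).toReal - ∫ u in S, ρ u)) *
        ∏ u ∈ c, ENNReal.ofReal (ρ u) := by
  have hprod := eq_mul_prod_of_insert (f := f) hpalm
  have hone := (E₀_eq_of_eq_mul_prod hd hSm hρ0 hρm hρint hprod).symm.trans hf
  have hempty : f ∅ = ENNReal.ofReal (Real.exp ((volume S).toReal - ∫ u in S, ρ u)) := by
    rw [ENNReal.eq_inv_of_mul_eq_one_left hone, ← ENNReal.ofReal_inv_of_pos (Real.exp_pos _),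
      ← Real.exp_neg, neg_sub]
  intro c hc
  rw [hprod c hc, hempty]

end PalmTutorial
end
end

section
/- (Joint intensities of a log Gaussian Cox process: product-exponential moment of a Gaussian vector.) Let Y = (Y₁,…,Y_n) be a Gaussian random vector in ℝ^n with mean vector μ = (μ₁,…,μ_n) and covariance matrix C = (c_{ij}) (symmetric positive semidefinite). Then E[ exp(Y₁)⋯exp(Y_n) ] = Π_{i=1}^n exp(μ_i + c_{ii}/2) · Π_{1 ≤ i < j ≤ n} exp(c_{ij}). Consequently, for a log Gaussian Cox process with Λ(x) = exp{Y(x)}, the intensity ρ(x) = exp{μ(x) + c(x,x)/2} and pair correlation g(u,v) = exp{c(u,v)} give ρ^{(n)}(x₁,…,x_n) = (Π_i ρ(x_i)) (Π_{i<j} g(x_i,x_j)). -/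
open MeasureTheory ProbabilityTheory ENNReal

noncomputable section

namespace PalmTutorial

/-- `Y` is a Gaussian random vector in `ℝ^n` with mean vector `μ` and covariance matrix
`C`: every linear combination `⟨t, Y⟩` is one-dimensional Gaussian with mean `⟨t, μ⟩` and
variance `⟨t, C t⟩`. -/
def IsGaussianVector {Ω : Type*} [MeasurableSpace Ω] (P : Measure Ω) {n : ℕ}
    (Y : Ω → Fin n → ℝ) (μ : Fin n → ℝ) (C : Matrix (Fin n) (Fin n) ℝ) : Prop :=
  ∀ t : Fin n → ℝ,
    Measure.map (fun ω => ∑ i, t i * Y ω i) P =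
      gaussianReal (∑ i, t i * μ i) (∑ i, ∑ j, t i * C i j * t j).toNNReal

lemma sum_sum_eq_sum_diag_add_two_mul_sum_lt {ι : Type*} [Fintype ι] [LinearOrder ι]
    (C : Matrix ι ι ℝ) (hC : C.IsSymm) :
    ∑ i, ∑ j, C i j =
      ∑ i, C i i + 2 * ∑ p ∈ Finset.univ.filter (fun p : ι × ι => p.1 < p.2), C p.1 p.2 := by
  have hsplit (p : ι × ι) : C p.1 p.2 = (if p.1 = p.2 then C p.1 p.2 else 0) +
      ((if p.1 < p.2 then C p.1 p.2 else 0) + if p.2 < p.1 then C p.1 p.2 else 0) := by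
    rcases lt_trichotomy p.1 p.2 with h | h | h
    · simp [h, h.ne, h.not_gt]
    · simp [h]
    · simp [h, h.ne', h.not_gt]
  have hdiag : ∑ p : ι × ι, (if p.1 = p.2 then C p.1 p.2 else 0) = ∑ i, C i i := by
    simp [Fintype.sum_prod_type]
  have hswap : ∑ p : ι × ι, (if p.2 < p.1 then C p.1 p.2 else 0) =
      ∑ p : ι × ι, (if p.1 < p.2 then C p.1 p.2 else 0) :=
    Fintype.sum_equiv (Equiv.prodComm ι ι) _ _ fun p => by simp [hC.apply p.1 p.2]
  rw [← Fintype.sum_prod_type' (f := fun i j => C i j), Finset.sum_congr rfl fun p _ => hsplit p,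
    Finset.sum_add_distrib, Finset.sum_add_distrib, hdiag, hswap, Finset.sum_filter]
  ring

lemma lintegral_ofReal_exp_gaussianReal (m : ℝ) (v : NNReal) :
    ∫⁻ x, ENNReal.ofReal (Real.exp x) ∂gaussianReal m v =
      ENNReal.ofReal (Real.exp (m + v / 2)) := by
  have hint : Integrable Real.exp (gaussianReal m v) := by
    simpa using integrable_exp_mul_gaussianReal (μ := m) (v := v) 1
  rw [← ofReal_integral_eq_lintegral_ofReal hint (ae_of_all _ fun x => (Real.exp_pos x).le)]
  have h := congrFun (mgf_id_gaussianReal (μ := m) (v := v)) 1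
  simp only [mgf, id, one_mul, mul_one, one_pow] at h
  rw [h]

/-- Joint intensities of a log Gaussian Cox process: product-exponential
moment of a Gaussian vector. For a Gaussian random vector `Y` with mean `μ` and
(symmetric positive semidefinite) covariance matrix `C = (c_{ij})`,
`E[ exp(Y₁)⋯exp(Y_n) ] = Π_{i} exp(μ_i + c_{ii}/2) · Π_{i<j} exp(c_{ij})`.
Consequently, for an LGCP with `Λ(x) = exp{Y(x)}`, intensity `ρ(x) = exp{μ(x)+c(x,x)/2}`
and pair correlation `g(u,v) = exp{c(u,v)}`, one has
`ρ^{(n)}(x₁,…,x_n) = (Π_i ρ(x_i)) (Π_{i<j} g(x_i,x_j))`. -/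
theorem statement14 {Ω : Type*} [MeasurableSpace Ω] (P : Measure Ω) [IsProbabilityMeasure P]
    {n : ℕ} (Y : Ω → Fin n → ℝ) (hYm : Measurable Y)
    (μ : Fin n → ℝ) (C : Matrix (Fin n) (Fin n) ℝ) (hC : C.PosSemidef)
    (hY : IsGaussianVector P Y μ C) :
    (∫⁻ ω, ENNReal.ofReal (∏ i, Real.exp (Y ω i)) ∂P) =
      ENNReal.ofReal ((∏ i, Real.exp (μ i + C i i / 2)) *
        ∏ p ∈ Finset.univ.filter (fun p : Fin n × Fin n => p.1 < p.2),
          Real.exp (C p.1 p.2)) := by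
  have hmap := hY 1
  simp only [Pi.one_apply, one_mul, mul_one] at hmap
  have hnonneg : 0 ≤ ∑ i, ∑ j, C i j := by
    simpa [dotProduct, Matrix.mulVec] using hC.dotProduct_mulVec_nonneg 1
  have hsymm : C.IsSymm := by simpa [Matrix.IsHermitian, Matrix.IsSymm] using hC.1
  simp_rw [← Real.exp_sum]
  rw [← lintegral_map (μ := P) (f := fun x => ENNReal.ofReal (Real.exp x))
    (g := fun ω => ∑ i, Y ω i) (by fun_prop) (by fun_prop), hmap,
    lintegral_ofReal_exp_gaussianReal, Real.coe_toNNReal _ hnonneg,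
    sum_sum_eq_sum_diag_add_two_mul_sum_lt C hsymm, ← Real.exp_add,
    Finset.sum_add_distrib, ← Finset.sum_div]
  congr 2
  ring

end PalmTutorial
end
end

section
/- (Determinantal point processes are closed under Palm conditioning: kernel of the reduced Palm process.) Let C : ℝ^d × ℝ^d → ℂ, let x₁,…,x_n ∈ ℝ^d be pairwise distinct such that the n×n matrix A = (C(x_i,x_j)) is invertible, and let u₁,…,u_m ∈ ℝ^d be pairwise distinct and distinct from the x_i. Define C_{x₁,…,x_n}(u,v) = C(u,v) − b(u)ᵀ A^{−1} c(v), where b(u) = (C(u,x_1),…,C(u,x_n))ᵀ and c(v) = (C(x_1,v),…,C(x_n,v))ᵀ. Then det[C](u₁,…,u_m,x₁,…,x_n) = det(A) · det[C_{x₁,…,x_n}](u₁,…,u_m). Consequently, if X is a determinantal point process with kernel C, its n-point reduced Palm joint intensities satisfy ρ^{(m+n)}(u₁,…,u_m,x₁,…,x_n)/ρ^{(n)}(x₁,…,x_n) = det[C_{x₁,…,x_n}](u₁,…,u_m), i.e. the reduced Palm process is determinantal with kernel C_{x₁,…,x_n}. -/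
open MeasureTheory ENNReal

noncomputable section

namespace PalmTutorial

/-- Schur complement formula for the determinant of a kernel evaluated at the points
`u₁, …, u_m, x₁, …, x_n`. -/
theorem det_kernel_append {E R : Type*} [CommRing R] (C : E → E → R) {n m : ℕ}
    (x : Fin n → E) (u : Fin m → E) (A : Matrix (Fin n) (Fin n) R)
    (hA : A = Matrix.of fun i j => C (x i) (x j)) (hAinv : IsUnit A.det) :
    Matrix.det (Matrix.of fun i j : Fin (m + n) =>
        C (Fin.append u x i) (Fin.append u x j)) =
      A.det * Matrix.det (Matrix.of fun k l : Fin m =>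
        C (u k) (u l) - ∑ i, ∑ j, C (u k) (x i) * A⁻¹ i j * C (x j) (u l)) := by
  let : Invertible A := A.invertibleOfIsUnitDet hAinv
  have hblock : (Matrix.of fun i j : Fin (m + n) =>
      C (Fin.append u x i) (Fin.append u x j)).submatrix finSumFinEquiv finSumFinEquiv =
      Matrix.fromBlocks (Matrix.of fun k l => C (u k) (u l)) (Matrix.of fun k i => C (u k) (x i))
        (Matrix.of fun j l => C (x j) (u l)) A := by
    subst hA
    ext (i | i) (j | j) <;> simp
  rw [← Matrix.det_submatrix_equiv_self finSumFinEquiv, hblock, Matrix.det_fromBlocks₂₂]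
  congr 2
  ext k l
  simp only [Matrix.invOf_eq_nonsing_inv, Matrix.sub_apply, Matrix.mul_apply, Matrix.of_apply,
    Finset.sum_mul]
  rw [Finset.sum_comm]

/-- Determinantal point processes are closed under Palm conditioning:
kernel of the reduced Palm process. Let `C : ℝ^d × ℝ^d → ℂ`, let `x₁,…,x_n` be pairwise
distinct points with `A = (C(x_i,x_j))` invertible, and let `u₁,…,u_m` be pairwise
distinct points, distinct from the `x_i` (all encoded by the injectivity of
`Fin.append u x`). With `C_{x₁,…,x_n}(u,v) = C(u,v) − b(u)ᵀ A⁻¹ c(v)`, one has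
`det[C](u₁,…,u_m,x₁,…,x_n) = det(A) · det[C_{x₁,…,x_n}](u₁,…,u_m)`; consequently, if `X`
is determinantal with kernel `C` (its joint intensities `ρ^{(k)}` are given by
determinants of `C`), then
`ρ^{(m+n)}(u₁,…,u_m,x₁,…,x_n)/ρ^{(n)}(x₁,…,x_n) = det[C_{x₁,…,x_n}](u₁,…,u_m)`,
i.e. the reduced Palm process is determinantal with kernel `C_{x₁,…,x_n}`. -/
theorem statement16 {d : ℕ} (hd : 1 ≤ d)
    (C : (Fin d → ℝ) → (Fin d → ℝ) → ℂ)
    (n m : ℕ) (hn : 1 ≤ n) (hm : 1 ≤ m)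
    (x : Fin n → (Fin d → ℝ)) (u : Fin m → (Fin d → ℝ))
    (hinj : Function.Injective (Fin.append u x))
    (A : Matrix (Fin n) (Fin n) ℂ) (hA : A = Matrix.of fun i j => C (x i) (x j))
    (hAinv : IsUnit A.det)
    (Cpalm : (Fin d → ℝ) → (Fin d → ℝ) → ℂ)
    (hCpalm : ∀ v w, Cpalm v w = C v w - ∑ i, ∑ j, C v (x i) * A⁻¹ i j * C (x j) w) :
    (Matrix.det (Matrix.of fun i j : Fin (m + n) =>
        C (Fin.append u x i) (Fin.append u x j)) =
      A.det * Matrix.det (Matrix.of fun i j : Fin m => Cpalm (u i) (u j))) ∧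
    ∀ ρ : (k : ℕ) → (Fin k → (Fin d → ℝ)) → ℂ,
      (∀ (k : ℕ) (y : Fin k → (Fin d → ℝ)), Function.Injective y →
        ρ k y = Matrix.det (Matrix.of fun i j => C (y i) (y j))) →
      ρ (m + n) (Fin.append u x) / ρ n x =
        Matrix.det (Matrix.of fun i j : Fin m => Cpalm (u i) (u j)) := by
  have hdet : Matrix.det (Matrix.of fun i j : Fin (m + n) =>
      C (Fin.append u x i) (Fin.append u x j)) =
      A.det * Matrix.det (Matrix.of fun i j : Fin m => Cpalm (u i) (u j)) := by
    simp only [hCpalm]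
    exact det_kernel_append C x u A hA hAinv
  refine ⟨hdet, fun ρ hρ => ?_⟩
  have hx : Function.Injective x := fun i j hij =>
    Fin.natAdd_injective n m (hinj (by simpa using hij))
  rw [hρ _ _ hinj, hρ _ _ hx, hdet, ← hA, mul_div_cancel_left₀ _ hAinv.ne_zero]

end PalmTutorial
end
end

section
/- (Marginal density of the restriction of a finite point process.) Let f be a point process density on S and B ⊆ S a Borel set. Define f_B(y) = E₀^{S\B}[ f(y ∪ ·) ] for finite configurations y ⊆ B. Then f_B is a point process density with respect to the unit-rate Poisson process on B (i.e. E₀^B[f_B] = 1), and for every nonnegative measurable function h on finite configurations of B: E₀^S[ f(x) · h(x ∩ B) ] = E₀^B[ f_B(y) · h(y) ]. -/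
open MeasureTheory ENNReal
open scoped Classical

noncomputable section

namespace PalmTutorial

/-- The `ℝ≥0∞`-module of measurable functions on finite configurations. -/
def measCfgSubmodule (d : ℕ) : Submodule ℝ≥0∞ (Config d → ℝ≥0∞) where
  carrier := {F | MeasCfg F}
  add_mem' hF hG n := (hF n).add (hG n)
  zero_mem' _ := measurable_const
  smul_mem' r _ hF n := (hF n).const_mul r

lemma tupCfg_cons {d n : ℕ} (u : Fin d → ℝ) (x : Fin n → (Fin d → ℝ)) :
    tupCfg (Fin.cons u x) = insert u (tupCfg x) := by
  ext v
  simp [tupCfg, Fin.exists_fin_succ, eq_comm]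

lemma exists_tupCfg_eq {d : ℕ} (c : Config d) :
    ∃ x : Fin c.card → (Fin d → ℝ), tupCfg x = c := by
  refine ⟨fun i => (c.equivFin.symm i : Fin d → ℝ), ?_⟩
  ext v
  simp only [tupCfg, Finset.mem_image, Finset.mem_univ, true_and]
  constructor
  · rintro ⟨i, rfl⟩
    exact (c.equivFin.symm i).2
  · intro hv
    exact ⟨c.equivFin ⟨v, hv⟩, by simp⟩

lemma tupCfg_append {d n m : ℕ} (x : Fin n → (Fin d → ℝ)) (y : Fin m → (Fin d → ℝ)) :
    tupCfg (Fin.append x y) = tupCfg x ∪ tupCfg y := by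
  ext v
  simp only [tupCfg, Finset.mem_image, Finset.mem_univ, true_and, Finset.mem_union]
  constructor
  · rintro ⟨i, rfl⟩
    refine Fin.addCases (fun i => ?_) (fun i => ?_) i
    · exact Or.inl ⟨i, by simp⟩
    · exact Or.inr ⟨i, by simp⟩
  · rintro (⟨i, rfl⟩ | ⟨i, rfl⟩)
    · exact ⟨Fin.castAdd m i, by simp⟩
    · exact ⟨Fin.natAdd n i, by simp⟩

lemma measurable_finCons {d n : ℕ} :
    Measurable fun p : (Fin d → ℝ) × (Fin n → (Fin d → ℝ)) =>
      (Fin.cons p.1 p.2 : Fin (n + 1) → (Fin d → ℝ)) := by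
  refine measurable_pi_lambda _ fun i => ?_
  refine Fin.cases ?_ (fun j => ?_) i
  · simpa using measurable_fst
  · simpa using (measurable_snd.eval :
      Measurable fun p : (Fin d → ℝ) × (Fin n → (Fin d → ℝ)) => p.2 j)

lemma MeasCfg.insert_tupCfg {d n : ℕ} {F : Config d → ℝ≥0∞} (hF : MeasCfg F) :
    Measurable fun p : (Fin d → ℝ) × (Fin n → (Fin d → ℝ)) => F (insert p.1 (tupCfg p.2)) := by
  simpa only [Function.comp_def, tupCfg_cons] using (hF (n + 1)).comp measurable_finCons

lemma MeasCfg.tupCfg_union {d : ℕ} {F : Config d → ℝ≥0∞} (hF : MeasCfg F) (c : Config d)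
    (n : ℕ) : Measurable fun x : Fin n → (Fin d → ℝ) => F (tupCfg x ∪ c) := by
  obtain ⟨w, hw⟩ := exists_tupCfg_eq c
  have hm : Measurable fun x : Fin n → (Fin d → ℝ) => Fin.append x w := by
    refine measurable_pi_lambda _ fun i => ?_
    refine Fin.addCases (fun i => ?_) (fun i => ?_) i
    · simpa using measurable_pi_apply i
    · simp
  simpa only [Function.comp_def, tupCfg_append, hw] using (hF _).comp hm

lemma MeasCfg.insert_insert {d : ℕ} {F : Config d → ℝ≥0∞} (hF : MeasCfg F) (c : Config d) :
    Measurable fun p : (Fin d → ℝ) × (Fin d → ℝ) => F (insert p.1 (insert p.2 c)) := by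
  obtain ⟨w, hw⟩ := exists_tupCfg_eq c
  have hm : Measurable fun p : (Fin d → ℝ) × (Fin d → ℝ) =>
      (p.1, (Fin.cons p.2 w : Fin (c.card + 1) → (Fin d → ℝ))) :=
    measurable_fst.prodMk (measurable_finCons.comp (measurable_snd.prodMk measurable_const))
  simpa only [Function.comp_def, tupCfg_cons, hw] using hF.insert_tupCfg.comp hm

lemma MeasCfg.insert {d : ℕ} {F : Config d → ℝ≥0∞} (hF : MeasCfg F) (c : Config d) :
    Measurable fun u : Fin d → ℝ => F (insert u c) := by
  obtain ⟨w, hw⟩ := exists_tupCfg_eq c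
  simpa only [Function.comp_def, hw, id] using
    hF.insert_tupCfg.comp (measurable_id.prodMk (measurable_const (a := w)))

/-- The operator sending `F` to `c ↦ ∫ F (c ∪ {u}) dμ(u)`. -/
def addPointOp {d : ℕ} (μ : Measure (Fin d → ℝ)) [SFinite μ] :
    Module.End ℝ≥0∞ (measCfgSubmodule d) where
  toFun F := ⟨fun c => ∫⁻ u, F.1 (insert u c) ∂μ, fun _ =>
    (MeasCfg.insert_tupCfg F.2).lintegral_prod_left'⟩
  map_add' F G := by
    ext c
    exact lintegral_add_left (MeasCfg.insert F.2 c) _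
  map_smul' r F := by
    ext c
    exact lintegral_const_mul r (MeasCfg.insert F.2 c)

lemma addPointOp_apply {d : ℕ} (μ : Measure (Fin d → ℝ)) [SFinite μ] (F : measCfgSubmodule d)
    (c : Config d) : (addPointOp μ F).1 c = ∫⁻ u, F.1 (insert u c) ∂μ := rfl

lemma addPointOp_add {d : ℕ} (μ ν : Measure (Fin d → ℝ)) [SFinite μ] [SFinite ν] :
    addPointOp (μ + ν) = addPointOp μ + addPointOp ν := by
  ext F c
  exact lintegral_add_measure _ μ ν

lemma addPointOp_commute {d : ℕ} (μ ν : Measure (Fin d → ℝ)) [SFinite μ] [SFinite ν] :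
    Commute (addPointOp μ) (addPointOp ν) := by
  refine LinearMap.ext fun F => Subtype.ext (funext fun c => ?_)
  change ∫⁻ u, ∫⁻ v, F.1 (insert v (insert u c)) ∂ν ∂μ =
    ∫⁻ v, ∫⁻ u, F.1 (insert u (insert v c)) ∂μ ∂ν
  rw [lintegral_lintegral_swap]
  · simp_rw [Finset.insert_comm]
  · exact ((MeasCfg.insert_insert F.2 c).comp measurable_swap).aemeasurable

lemma lintegral_pi_tupCfg_union {d : ℕ} (μ : Measure (Fin d → ℝ)) [SigmaFinite μ] (n : ℕ)
    (F : measCfgSubmodule d) (c : Config d) :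
    ∫⁻ x : Fin n → (Fin d → ℝ), F.1 (tupCfg x ∪ c) ∂(Measure.pi fun _ => μ) =
      ((addPointOp μ ^ n) F).1 c := by
  induction n generalizing F with
  | zero =>
    rw [lintegral_unique]
    simp [tupCfg]
  | succ n ih =>
    have hmp := (measurePreserving_piFinSuccAbove (fun _ : Fin (n + 1) => μ) 0).symm
    rw [← hmp.lintegral_comp (MeasCfg.tupCfg_union F.2 c (n + 1)), pow_succ, Module.End.mul_apply,
      ← ih, lintegral_prod_symm]
    · refine lintegral_congr fun x => ?_
      rw [addPointOp_apply]
      refine lintegral_congr fun u => ?_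
      rw [← Finset.insert_union, ← tupCfg_cons]
      simp [MeasurableEquiv.piFinSuccAbove, Fin.insertNthEquiv]
    · exact ((MeasCfg.tupCfg_union F.2 c (n + 1)).comp hmp.measurable).aemeasurable

lemma ae_pi_restrict_mem {d : ℕ} {T : Set (Fin d → ℝ)} (hT : MeasurableSet T) (n : ℕ) :
    ∀ᵐ x ∂(restMeas d T n), ∀ i, x i ∈ T := by
  rw [restMeas, ← Measure.restrict_pi_pi]
  filter_upwards [ae_restrict_mem (MeasurableSet.univ_pi fun _ => hT)] with x hx i
  exact hx i trivial

lemma MeasCfg.filter_mem {d : ℕ} {h : Config d → ℝ≥0∞} (hh : MeasCfg h) {B : Set (Fin d → ℝ)}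
    (hB : MeasurableSet B) : MeasCfg fun c => h (c.filter (fun u => u ∈ B)) := by
  intro n
  have key : (fun x : Fin n → (Fin d → ℝ) => h ((tupCfg x).filter (fun u => u ∈ B))) =
      fun x => ∑ J : Finset (Fin n), {x : Fin n → (Fin d → ℝ) | ∀ i, x i ∈ B ↔ i ∈ J}.indicator
        (fun x => h (tupCfg (x ∘ J.orderEmbOfFin rfl))) x := by
    funext x
    rw [Finset.sum_eq_single (Finset.univ.filter fun i => x i ∈ B)]
    · rw [Set.indicator_of_mem (by simp)]
      congr 1
      ext v
      simp only [tupCfg, Finset.mem_filter, Finset.mem_image, Finset.mem_univ, true_and,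
        Function.comp_apply]
      constructor
      · rintro ⟨⟨i, rfl⟩, hi⟩
        have : i ∈ Set.range ((Finset.univ.filter fun i => x i ∈ B).orderEmbOfFin rfl) := by
          rw [Finset.range_orderEmbOfFin]
          simpa using hi
        obtain ⟨j, hj⟩ := this
        exact ⟨j, by rw [hj]⟩
      · rintro ⟨j, rfl⟩
        refine ⟨⟨_, rfl⟩, ?_⟩
        have := Finset.orderEmbOfFin_mem (Finset.univ.filter fun i => x i ∈ B) rfl j
        exact (Finset.mem_filter.1 this).2
    · intro J _ hJ
      refine Set.indicator_of_notMem (fun hx => hJ ?_) _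
      ext i
      simpa using (hx i).symm
    · simp
  change Measurable fun x : Fin n → (Fin d → ℝ) => h ((tupCfg x).filter (fun u => u ∈ B))
  rw [key]
  refine Finset.measurable_sum _ fun J _ => Measurable.indicator ?_ ?_
  · exact (hh _).comp (measurable_pi_lambda _ fun i => measurable_pi_apply _)
  · have : {x : Fin n → (Fin d → ℝ) | ∀ i, x i ∈ B ↔ i ∈ J} =
        ⋂ i, {x | x i ∈ B ↔ i ∈ J} := by ext; simp
    rw [this]
    refine MeasurableSet.iInter fun i => ?_
    have hi : MeasurableSet {x : Fin n → (Fin d → ℝ) | x i ∈ B} := measurable_pi_apply i hB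
    by_cases hJ : i ∈ J
    · simpa only [hJ, iff_true] using hi
    · simp only [hJ, iff_false]
      exact hi.compl

lemma div_factorial_mul_choose (p q : ℝ≥0∞) (k m : ℕ) :
    p * q / ((k + m).factorial : ℝ≥0∞) * ((k + m).choose k : ℝ≥0∞) =
      p / (k.factorial : ℝ≥0∞) * (q / (m.factorial : ℝ≥0∞)) := by
  have h : ((k + m).factorial : ℝ≥0∞) = (k + m).choose k * (k.factorial * m.factorial) := by
    rw [← Nat.add_choose_mul_factorial_mul_factorial, ← Nat.choose_symm_add]
    push_cast
    ring
  have hc : ((k + m).choose k : ℝ≥0∞) ≠ 0 :=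
    Nat.cast_ne_zero.2 (Nat.choose_pos (Nat.le_add_right k m)).ne'
  have hk : (k.factorial : ℝ≥0∞) ≠ 0 := Nat.cast_ne_zero.2 k.factorial_ne_zero
  rw [h, div_eq_mul_inv, div_eq_mul_inv, div_eq_mul_inv,
    ENNReal.mul_inv (Or.inl hc) (Or.inl (natCast_ne_top _)),
    ENNReal.mul_inv (Or.inl hk) (Or.inl (natCast_ne_top _))]
  calc _ = p * (k.factorial : ℝ≥0∞)⁻¹ * (q * (m.factorial : ℝ≥0∞)⁻¹) *
        (((k + m).choose k : ℝ≥0∞)⁻¹ * ((k + m).choose k : ℝ≥0∞)) := by ring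
    _ = _ := by rw [ENNReal.inv_mul_cancel hc (natCast_ne_top _), mul_one]

lemma E₀_union_eq_tsum {d : ℕ} (T : Set (Fin d → ℝ)) (F : measCfgSubmodule d) (c : Config d) :
    E₀ T (fun z => F.1 (c ∪ z)) = ∑' n : ℕ, (ENNReal.ofReal (Real.exp (-(volume T).toReal)) /
      (Nat.factorial n : ℝ≥0∞)) * ((addPointOp (volume.restrict T) ^ n) F).1 c := by
  simp_rw [E₀, restMeas, ← lintegral_pi_tupCfg_union, Finset.union_comm c]

lemma E₀_eq_tsum {d : ℕ} (T : Set (Fin d → ℝ)) (F : measCfgSubmodule d) :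
    E₀ T F.1 = ∑' n : ℕ, (ENNReal.ofReal (Real.exp (-(volume T).toReal)) /
      (Nat.factorial n : ℝ≥0∞)) * ((addPointOp (volume.restrict T) ^ n) F).1 ∅ := by
  simpa only [Finset.empty_union] using E₀_union_eq_tsum T F ∅

/-- The Poisson expectation over `S` splits into independent expectations over `B` and `S \ B`. -/
lemma E₀_eq_E₀_E₀_diff {d : ℕ} {S B : Set (Fin d → ℝ)} (hS : volume S ≠ ∞)
    (hBm : MeasurableSet B) (hBS : B ⊆ S) {F : Config d → ℝ≥0∞} (hF : MeasCfg F) :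
    E₀ S F = E₀ B (fun y => E₀ (S \ B) (fun z => F (y ∪ z))) := by
  obtain ⟨F, rfl⟩ : ∃ F' : measCfgSubmodule d, F'.1 = F := ⟨⟨F, hF⟩, rfl⟩
  have hμ : volume.restrict S = volume.restrict B + volume.restrict (S \ B) := by
    rw [← Measure.restrict_inter_add_sdiff S hBm, Set.inter_eq_right.2 hBS]
  have hp : ENNReal.ofReal (Real.exp (-(volume S).toReal)) =
      ENNReal.ofReal (Real.exp (-(volume B).toReal)) *
        ENNReal.ofReal (Real.exp (-(volume (S \ B)).toReal)) := by
    rw [← ENNReal.ofReal_mul (Real.exp_nonneg _), ← Real.exp_add, ← neg_add,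
      ← ENNReal.toReal_add (measure_ne_top_of_subset hBS hS)
        (measure_ne_top_of_subset Set.sdiff_subset hS), ← measure_inter_add_sdiff S hBm,
      Set.inter_eq_right.2 hBS]
  set p := ENNReal.ofReal (Real.exp (-(volume B).toReal))
  set q := ENNReal.ofReal (Real.exp (-(volume (S \ B)).toReal))
  have hleft : E₀ S F.1 = ∑' n : ℕ, ∑ a ∈ Finset.HasAntidiagonal.antidiagonal n,
      p / (a.1.factorial : ℝ≥0∞) * (q / (a.2.factorial : ℝ≥0∞)) *
        ((addPointOp (volume.restrict B) ^ a.1)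
          ((addPointOp (volume.restrict (S \ B)) ^ a.2) F)).1 ∅ := by
    rw [E₀_eq_tsum]
    refine tsum_congr fun n => ?_
    have : addPointOp (volume.restrict S) =
        addPointOp (volume.restrict B) + addPointOp (volume.restrict (S \ B)) := by
      rw [← addPointOp_add]
      congr 1
    rw [this, (addPointOp_commute _ _).add_pow', LinearMap.sum_apply, hp,
      AddSubmonoidClass.coe_finsetSum, Finset.sum_apply, Finset.mul_sum]
    refine Finset.sum_congr rfl fun a ha => ?_
    obtain rfl := Finset.HasAntidiagonal.mem_antidiagonal.1 ha
    rw [← div_factorial_mul_choose, mul_assoc]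
    simp [Module.End.mul_apply]
  have hright : E₀ B (fun y => E₀ (S \ B) (fun z => F.1 (y ∪ z))) = ∑' k : ℕ, ∑' m : ℕ,
      p / (k.factorial : ℝ≥0∞) * (q / (m.factorial : ℝ≥0∞)) *
        ((addPointOp (volume.restrict B) ^ k)
          ((addPointOp (volume.restrict (S \ B)) ^ m) F)).1 ∅ := by
    simp_rw [E₀_union_eq_tsum]
    rw [E₀]
    refine tsum_congr fun k => ?_
    rw [lintegral_tsum fun m =>
      ((((addPointOp (volume.restrict (S \ B)) ^ m) F).2 k).const_mul _).aemeasurable,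
      ← ENNReal.tsum_mul_left]
    refine tsum_congr fun m => ?_
    rw [lintegral_const_mul _ (((addPointOp (volume.restrict (S \ B)) ^ m) F).2 k), mul_assoc,
      ← lintegral_pi_tupCfg_union]
    simp_rw [Finset.union_empty]
    rfl
  rw [hleft, hright, ← ENNReal.tsum_prod,
    ← Finset.HasAntidiagonal.sigmaAntidiagonalEquivProd.tsum_eq,
    ENNReal.tsum_sigma']
  refine tsum_congr fun n => ?_
  rw [tsum_fintype, ← Finset.sum_coe_sort]
  rfl

lemma E₀_congr {d : ℕ} {T : Set (Fin d → ℝ)} (hT : MeasurableSet T) {F G : Config d → ℝ≥0∞}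
    (h : ∀ c : Config d, (∀ u ∈ c, u ∈ T) → F c = G c) : E₀ T F = E₀ T G := by
  refine tsum_congr fun n => ?_
  congr 1
  refine lintegral_congr_ae ?_
  filter_upwards [ae_pi_restrict_mem hT n] with x hx
  refine h _ fun u hu => ?_
  obtain ⟨i, -, rfl⟩ := Finset.mem_image.1 hu
  exact hx i

lemma E₀_mul_const {d : ℕ} (T : Set (Fin d → ℝ)) {F : Config d → ℝ≥0∞} (hF : MeasCfg F)
    (r : ℝ≥0∞) : E₀ T (fun c => F c * r) = E₀ T F * r := by
  simp_rw [E₀, ← ENNReal.tsum_mul_right]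
  exact tsum_congr fun n => by rw [lintegral_mul_const _ (hF n), mul_assoc]

/-- Marginal density of the restriction of a finite point process. Let `f`
be a point process density on `S`, `B ⊆ S` Borel, and
`f_B(y) = E₀^{S\B}[ f(y ∪ ·) ]` for configurations `y ⊆ B`. Then `f_B` is a point process
density with respect to the unit-rate Poisson process on `B` (`E₀^B[f_B] = 1`), and for
every nonnegative measurable `h` on configurations of `B`:
`E₀^S[ f(x) · h(x ∩ B) ] = E₀^B[ f_B(y) · h(y) ]`. -/
theorem statement18 {d : ℕ} (hd : 1 ≤ d) (S : Set (Fin d → ℝ)) (hSm : MeasurableSet S)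
    (hSb : Bornology.IsBounded S)
    (f : Config d → ℝ≥0∞) (hfm : MeasCfg f) (hf : E₀ S f = 1)
    (B : Set (Fin d → ℝ)) (hBm : MeasurableSet B) (hBS : B ⊆ S) :
    E₀ B (fun y => E₀ (S \ B) (fun z => f (y ∪ z))) = 1 ∧
    ∀ h : Config d → ℝ≥0∞, MeasCfg h →
      E₀ S (fun c => f c * h (c.filter (fun u => u ∈ B))) =
        E₀ B (fun y => E₀ (S \ B) (fun z => f (y ∪ z)) * h y) := by
  have hS : volume S ≠ ∞ := hSb.measure_lt_top.ne
  have main : ∀ h : Config d → ℝ≥0∞, MeasCfg h →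
      E₀ S (fun c => f c * h (c.filter (fun u => u ∈ B))) =
        E₀ B (fun y => E₀ (S \ B) (fun z => f (y ∪ z)) * h y) := by
    intro h hh
    rw [E₀_eq_E₀_E₀_diff hS hBm hBS fun n => (hfm n).mul (hh.filter_mem hBm n)]
    refine E₀_congr hBm fun y hy => ?_
    have hfy : MeasCfg fun z => f (y ∪ z) := fun n => by
      simpa only [Finset.union_comm y] using hfm.tupCfg_union y n
    rw [← E₀_mul_const _ hfy]
    refine E₀_congr (hSm.diff hBm) fun z hz => ?_
    rw [Finset.filter_union, Finset.filter_true_of_mem hy,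
      Finset.filter_false_of_mem fun u hu => (hz u hu).2, Finset.union_empty]
  refine ⟨?_, main⟩
  have h1 := main (fun _ => 1) fun _ => measurable_const
  simp only [mul_one] at h1
  rw [← h1, hf]

end PalmTutorial
end
end
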